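/- Let d ≥ 2, α ∈ (0,2), and let D = B(0,1) ⊂ ℝ^d be the open Euclidean unit ball. Let φ : closure(D) → ℝ be continuous, twice continuously differentiable on D, and satisfy φ(x) = (1−|x|)^{α/2} for every x ∈ closure(D) with 1−|x| ≤ 1/2 (note that 1−|x| = dist(x, ℝ^d ∖ D) for x ∈ closure(D)). Then sup_{x ∈ D} |𝓛φ(x)| < ∞. -/

import Mathlib

open MeasureTheory Metric Set Bornology
open scoped RealInnerProductSpace

noncomputable section

/-- `lamT D y z` is the largest `t ∈ [0,1]` such that `y + t • (z - y) ∈ closure D`. -/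
def lamT {d : ℕ} (D : Set (EuclideanSpace ℝ (Fin d)))
    (y z : EuclideanSpace ℝ (Fin d)) : ℝ :=
  sSup {t : ℝ | t ∈ Set.Icc (0 : ℝ) 1 ∧ y + t • (z - y) ∈ closure D}

/-- The cutoff map `Λ`. -/
def Lam {d : ℕ} (D : Set (EuclideanSpace ℝ (Fin d)))
    (y z : EuclideanSpace ℝ (Fin d)) : EuclideanSpace ℝ (Fin d) :=
  y + lamT D y z • (z - y)

/-- The fractional operator `𝓛φ(x)` with truncation level `a` in the gradient term. -/
def Lgen {d : ℕ} (D : Set (EuclideanSpace ℝ (Fin d))) (α a : ℝ)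
    (φ : EuclideanSpace ℝ (Fin d) → ℝ) (x : EuclideanSpace ℝ (Fin d)) : ℝ :=
  ∫ z : EuclideanSpace ℝ (Fin d),
    (φ (Lam D x (x + z)) - φ x - (if ‖z‖ < a then ⟪z, gradient φ x⟫ else 0))
      * ‖z‖ ^ (-(d : ℝ) - α)


lemma holder_aux {s x y : ℝ} (hs0 : 0 < s) (hs1 : s < 1) (hx : 0 ≤ x) (hy : 0 ≤ y) :
    |x ^ s - y ^ s| ≤ |x - y| ^ s := by
  wlog h : y ≤ x generalizing x y
  · rw [abs_sub_comm, abs_sub_comm x y]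
    exact this hy hx (le_of_not_ge h)
  have h1 : y ^ s ≤ x ^ s := Real.rpow_le_rpow hy h hs0.le
  rw [abs_of_nonneg (by linarith), abs_of_nonneg (by linarith)]
  have := Real.rpow_add_le_add_rpow (p := s) (a := x - y) (b := y) (by linarith) hy hs0.le hs1.le
  rw [sub_add_cancel] at this
  linarith

lemma bern_up {s r : ℝ} (hs0 : 0 < s) (hs1 : s < 1) (hr : -1 ≤ r) :
    (1 + r) ^ s ≤ 1 + s * r :=
  rpow_one_add_le_one_add_mul_self hr hs0.le hs1.le

lemma low_aux {s r : ℝ} (hs0 : 0 < s) (hs1 : s < 1) (hr : 0 ≤ r) (hr1 : r ≤ 1) :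
    1 - r ≤ (1 - r) ^ s := by
  have := Real.rpow_le_rpow_of_exponent_ge_of_imp (x := 1 - r) (y := 1) (z := s)
    (by linarith) (by linarith) hs1.le (by intro h h'; linarith)
  rwa [Real.rpow_one] at this

lemma secdiff {s r : ℝ} (hs0 : 0 < s) (hs1 : s < 1) (hr : 0 ≤ r) (hr1 : r ≤ 1) :
    |(1 + r) ^ s + (1 - r) ^ s - 2| ≤ 2 * r ^ 2 := by
  have h1 := bern_up (r := r) hs0 hs1 (by linarith)
  have h2 := bern_up (r := -r) hs0 hs1 (by linarith)
  rw [← sub_eq_add_neg] at h2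
  have h3 := low_aux (r := r ^ 2) hs0 hs1 (by positivity) (by nlinarith)
  have h4 : (1 - r ^ 2) ^ s = (1 + r) ^ s * (1 - r) ^ s := by
    rw [← Real.mul_rpow (by linarith) (by linarith)]; ring_nf
  have h5 : 0 ≤ (1 + r) ^ s := by positivity
  have h6 : 0 ≤ (1 - r) ^ s := Real.rpow_nonneg (by linarith) _
  rw [abs_le]
  constructor
  · rw [h4] at h3
    set a := (1 + r) ^ s
    set b := (1 - r) ^ s
    -- (a+b)^2 ≥ 4ab ≥ 4(1-r^2)
    by_contra hc
    push Not at hc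
    have : (a + b) < 2 * (1 - r ^ 2) := by linarith
    nlinarith [sq_nonneg (a - b), sq_nonneg r, mul_nonneg h5 h6]
  · nlinarith [sq_nonneg r]

lemma lip_aux {s r : ℝ} (hs0 : 0 < s) (hs1 : s < 1) (hr : 0 ≤ r) (hr1 : r ≤ 1) :
    |(1 + r) ^ s - 1| ≤ r ∧ |(1 - r) ^ s - 1| ≤ r := by
  have h1 := bern_up (r := r) hs0 hs1 (by linarith)
  have h3 := low_aux (r := r) hs0 hs1 (by positivity) hr1
  have h4 : 1 ≤ (1 + r) ^ s := Real.one_le_rpow (by linarith) hs0.le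
  have h5 : (1 - r) ^ s ≤ 1 := Real.rpow_le_one (by linarith) (by linarith) hs0.le
  constructor <;> rw [abs_le] <;> constructor <;> nlinarith

/-- dominating function -/
def domf (s r : ℝ) : ℝ := if r ≤ 1 then r ^ (-s) else r ^ (-1 - s)

lemma domf_nonneg {s r : ℝ} (hr : 0 ≤ r) : 0 ≤ domf s r := by
  unfold domf; split_ifs <;> positivity

lemma domf_int {s : ℝ} (hs0 : 0 < s) (hs1 : s < 1) : IntegrableOn (domf s) (Ioi 0) := by
  rw [← Ioc_union_Ioi_eq_Ioi (zero_le_one (α := ℝ))]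
  refine IntegrableOn.union ?_ ?_
  · have : IntegrableOn (fun r : ℝ => r ^ (-s)) (Ioc 0 1) := by
      have := (intervalIntegral.intervalIntegrable_rpow' (a := 0) (b := 1) (r := -s) (by linarith))
      rwa [intervalIntegrable_iff_integrableOn_Ioc_of_le zero_le_one] at this
    refine this.congr_fun ?_ measurableSet_Ioc
    intro r hr; simp [domf, hr.2]
  · have : IntegrableOn (fun r : ℝ => r ^ (-1 - s)) (Ioi 1) :=
      integrableOn_Ioi_rpow_of_lt (by linarith) one_pos
    refine this.congr_fun ?_ measurableSet_Ioi
    intro r hr; simp [domf, not_le.2 hr.out]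

/-- half-line integrand -/
def halff (s a r : ℝ) : ℝ := ((a + r) ^ s + (max 0 (a - r)) ^ s - 2 * a ^ s) * r ^ (-1 - 2 * s)

lemma halff_meas (s a : ℝ) : Measurable (halff s a) := by
  unfold halff; fun_prop

lemma halff_le1 {s r : ℝ} (hs0 : 0 < s) (hs1 : s < 1) (hr : 0 < r) (hr1 : r ≤ 1) :
    |halff s 1 r| ≤ 2 * r ^ (1 - 2 * s) := by
  unfold halff
  rw [max_eq_right (by linarith), abs_mul, abs_of_nonneg (Real.rpow_nonneg hr.le (-1 - 2 * s))]
  have h : r ^ (1 - 2 * s) = r ^ 2 * r ^ (-1 - 2 * s) := by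
    rw [← Real.rpow_natCast, ← Real.rpow_add hr]; congr 1; push_cast; ring
  rw [h, ← mul_assoc]
  gcongr
  simpa using secdiff hs0 hs1 hr.le hr1

lemma halff_le2 {s r a : ℝ} (hs0 : 0 < s) (hs1 : s < 1) (ha : 0 < a) (hr : 0 < r) :
    |halff s a r| ≤ 2 * r ^ (-1 - s) := by
  unfold halff
  rw [abs_mul, abs_of_nonneg (Real.rpow_nonneg hr.le (-1 - 2 * s))]
  have h : r ^ (-1 - s) = r ^ s * r ^ (-1 - 2 * s) := by
    rw [← Real.rpow_add hr]; congr 1; ring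
  rw [h, ← mul_assoc]
  gcongr
  have h1 := holder_aux hs0 hs1 (x := a + r) (y := a) (by linarith) ha.le
  have h2 := holder_aux hs0 hs1 (x := max 0 (a - r)) (y := a) (by simp) ha.le
  rw [add_sub_cancel_left, abs_of_pos hr] at h1
  have h3 : |max 0 (a - r) - a| ≤ r := by
    rcases max_cases 0 (a - r) with h | h <;> rw [h.1, abs_le] <;> constructor <;> linarith
  have h4 := Real.rpow_le_rpow (abs_nonneg _) h3 hs0.le
  rw [abs_le] at *
  constructor <;> linarith

lemma halff_int {s : ℝ} (hs0 : 0 < s) (hs1 : s < 1) : IntegrableOn (halff s 1) (Ioi 0) := by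
  refine Integrable.mono' ((domf_int hs0 hs1).const_mul 2) (halff_meas s 1).aestronglyMeasurable ?_
  refine (ae_restrict_iff' measurableSet_Ioi).2 (.of_forall fun r hr => ?_)
  have hr : 0 < r := hr
  unfold domf
  split_ifs with h
  · refine (halff_le1 hs0 hs1 hr h).trans ?_
    gcongr 2 * ?_
    exact Real.rpow_le_rpow_of_exponent_ge hr h (by linarith)
  · exact halff_le2 hs0 hs1 one_pos hr

lemma fA_int {s e : ℝ} (hs0 : 0 < s) (he : 0 < e) :
    IntegrableOn (fun r : ℝ => (1 + r) ^ s * r ^ (-1 - 2 * s) + (1 + r) ^ (s - 1) * r ^ (-1 - 2 * s)) (Ioi e) ∧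
    ∫ r in Ioi e, ((1 + r) ^ s * r ^ (-1 - 2 * s) + (1 + r) ^ (s - 1) * r ^ (-1 - 2 * s))
      = (1 / s) * ((1 + e) ^ s * e ^ (-2 * s)) := by
  have hder : ∀ r ∈ Ici e, HasDerivAt (fun r : ℝ => - (1 / s) * ((1 + r) ^ s * r ^ (-2 * s)))
      ((1 + r) ^ s * r ^ (-1 - 2 * s) + (1 + r) ^ (s - 1) * r ^ (-1 - 2 * s)) r := by
    intro r hr
    have hr : 0 < r := lt_of_lt_of_le he hr
    have h1 : HasDerivAt (fun r : ℝ => (1 + r) ^ s) (1 * s * (1 + r) ^ (s - 1)) r :=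
      ((hasDerivAt_id r).const_add 1).rpow_const (Or.inl (by simp; linarith))
    have h2 : HasDerivAt (fun r : ℝ => r ^ (-2 * s)) (1 * (-2 * s) * r ^ (-2 * s - 1)) r :=
      (hasDerivAt_id r).rpow_const (Or.inl hr.ne')
    have h3 := (h1.fun_mul h2).const_mul (-(1 / s))
    refine h3.congr_deriv ?_
    have e1 : (1 + r) ^ s = (1 + r) ^ (s - 1) * (1 + r) := by
      rw [← Real.rpow_add_one (by linarith)]; ring_nf
    have e2 : r ^ (-2 * s) = r ^ (-1 - 2 * s) * r := by
      rw [← Real.rpow_add_one (by linarith)]; ring_nf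
    have e3 : r ^ (-2 * s - 1) = r ^ (-1 - 2 * s) := by ring_nf
    rw [e3, e1, e2]
    field_simp
    ring
  have hlim : Filter.Tendsto (fun r : ℝ => - (1 / s) * ((1 + r) ^ s * r ^ (-2 * s))) Filter.atTop (nhds 0) := by
    rw [show (0 : ℝ) = -(1 / s) * 0 by simp]
    refine Filter.Tendsto.const_mul _ ?_
    have h0 : Filter.Tendsto (fun r : ℝ => 2 ^ s * r ^ (-s)) Filter.atTop (nhds 0) := by
      simpa using (tendsto_rpow_neg_atTop hs0).const_mul (2 ^ s)
    refine squeeze_zero' ?_ ?_ h0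
    · filter_upwards [Filter.eventually_gt_atTop 0] with r hr
      positivity
    · filter_upwards [Filter.eventually_ge_atTop 1] with r hr
      have hr0 : 0 < r := by linarith
      calc (1 + r) ^ s * r ^ (-2 * s) ≤ (2 * r) ^ s * r ^ (-2 * s) := by
            gcongr; linarith
        _ = 2 ^ s * (r ^ s * r ^ (-2 * s)) := by rw [Real.mul_rpow (by norm_num) hr0.le]; ring
        _ = 2 ^ s * r ^ (-s) := by rw [← Real.rpow_add hr0]; ring_nf
  have hc : ContinuousWithinAt (fun r : ℝ => - (1 / s) * ((1 + r) ^ s * r ^ (-2 * s))) (Ici e) e :=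
    (hder e self_mem_Ici).continuousAt.continuousWithinAt
  have hnn : ∀ r ∈ Ioi e, 0 ≤ (1 + r) ^ s * r ^ (-1 - 2 * s) + (1 + r) ^ (s - 1) * r ^ (-1 - 2 * s) := by
    intro r hr
    have hr : 0 < r := lt_trans he hr
    positivity
  have hd := fun r (hr : r ∈ Ioi e) => hder r (Ioi_subset_Ici_self hr)
  refine ⟨integrableOn_Ioi_deriv_of_nonneg hc hd hnn hlim, ?_⟩
  rw [integral_Ioi_of_hasDerivAt_of_nonneg hc hd hnn hlim]
  ring

lemma image_aux {e : ℝ} (he : 0 < e) (he1 : e < 1) :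
    (fun r : ℝ => r / (1 + r)) '' Ioi (e / (1 - e)) = Ioo e 1 := by
  ext y
  simp only [mem_image, mem_Ioi, mem_Ioo]
  constructor
  · rintro ⟨r, hr, rfl⟩
    rw [div_lt_iff₀ (by linarith)] at hr
    have hr0 : 0 < r := by nlinarith
    constructor
    · rw [lt_div_iff₀ (by linarith)]; nlinarith
    · rw [div_lt_one (by linarith)]; linarith
  · rintro ⟨h1, h2⟩
    refine ⟨y / (1 - y), ?_, ?_⟩
    · rw [div_lt_div_iff₀ (by linarith) (by linarith)]; nlinarith
    · have : 1 - y ≠ 0 := by linarith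
      field_simp
      ring

lemma subst_aux {s e : ℝ} (he : 0 < e) (he1 : e < 1) :
    ∫ r in Ioo e 1, (1 - r) ^ s * r ^ (-1 - 2 * s) =
      ∫ r in Ioi (e / (1 - e)), (1 + r) ^ (s - 1) * r ^ (-1 - 2 * s) := by
  have hpos : 0 < e / (1 - e) := div_pos he (by linarith)
  rw [← image_aux he he1]
  rw [integral_image_eq_integral_abs_deriv_smul (f' := fun r => 1 / (1 + r) ^ 2) measurableSet_Ioi]
  · refine setIntegral_congr_fun measurableSet_Ioi ?_
    intro r hr
    have hr : 0 < r := hpos.trans hr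
    have h1 : 0 < 1 + r := by linarith
    simp only [smul_eq_mul]
    rw [abs_of_pos (by positivity)]
    have e1 : 1 - r / (1 + r) = (1 + r)⁻¹ := by field_simp; ring
    rw [e1, Real.div_rpow hr.le h1.le, Real.inv_rpow h1.le, div_eq_mul_inv (r ^ _), ← Real.rpow_neg h1.le,
      ← Real.rpow_neg h1.le, one_div, ← Real.rpow_natCast, ← Real.rpow_neg h1.le]
    rw [show (1 + r) ^ (-((2 : ℕ) : ℝ)) * ((1 + r) ^ (-s) * (r ^ (-1 - 2 * s) * (1 + r) ^ (-(-1 - 2 * s)))) =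
      ((1 + r) ^ (-((2 : ℕ) : ℝ)) * (1 + r) ^ (-s) * (1 + r) ^ (-(-1 - 2 * s))) * r ^ (-1 - 2 * s) by ring]
    rw [← Real.rpow_add h1, ← Real.rpow_add h1]
    congr 2
    push_cast
    ring
  · intro r hr
    have hr : 0 < r := hpos.trans hr
    have := (hasDerivAt_id' r).fun_div ((hasDerivAt_id' r).const_add 1) (by linarith)
    refine (this.congr_deriv ?_).hasDerivWithinAt
    ring
  · intro a ha b hb hab
    have ha : 0 < a := hpos.trans ha
    have hb : 0 < b := hpos.trans hb
    simp only at hab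
    rw [div_eq_div_iff (by linarith) (by linarith)] at hab
    linarith

lemma tail_bound {s e : ℝ} (hs0 : 0 < s) (hs1 : s < 1) (he : 0 < e) (he1 : e ≤ 1 / 2) :
    |∫ r in Ioi e, halff s 1 r| ≤ (1 / (2 * s) + 2) * e ^ (2 - 2 * s) := by
  set e' := e / (1 - e) with he'
  have h1e : 0 < 1 - e := by linarith
  have hpos : 0 < e' := div_pos he h1e
  have hle : e ≤ e' := by rw [he', le_div_iff₀ h1e]; nlinarith
  set A1 : ℝ → ℝ := fun r => (1 + r) ^ s * r ^ (-1 - 2 * s) with hA1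
  set A2 : ℝ → ℝ := fun r => (1 + r) ^ (s - 1) * r ^ (-1 - 2 * s) with hA2
  set A3 : ℝ → ℝ := fun r => r ^ (-1 - 2 * s) with hA3
  have i12 : ∀ x > 0, IntegrableOn (fun r => A1 r + A2 r) (Ioi x) := fun x hx => (fA_int hs0 hx).1
  have i1 : ∀ x > 0, IntegrableOn A1 (Ioi x) := by
    intro x hx
    refine Integrable.mono' (i12 x hx) (by simp only [hA1]; exact Measurable.aestronglyMeasurable (by fun_prop)) ?_
    refine (ae_restrict_iff' measurableSet_Ioi).2 (.of_forall fun r hr => ?_)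
    have hr : 0 < r := hx.trans hr
    have a1 : 0 ≤ A1 r := by simp only [hA1]; positivity
    have a2 : 0 ≤ A2 r := by simp only [hA2]; positivity
    rw [Real.norm_of_nonneg a1]; linarith
  have i2 : ∀ x > 0, IntegrableOn A2 (Ioi x) := by
    intro x hx
    refine Integrable.congr ((i12 x hx).sub (i1 x hx)) (.of_forall fun r => ?_)
    simp
  have i3 : ∀ x > 0, IntegrableOn A3 (Ioi x) := fun x hx =>
    integrableOn_Ioi_rpow_of_lt (by linarith) hx
  have ih : IntegrableOn (halff s 1) (Ioi e) := (halff_int hs0 hs1).mono_set (Ioi_subset_Ioi he.le)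
  set M : ℝ → ℝ := fun r => (max 0 (1 - r)) ^ s * r ^ (-1 - 2 * s) with hM
  have hdec : ∀ r, halff s 1 r = A1 r + M r - 2 * A3 r := by
    intro r; simp only [halff, hA1, hM, hA3, Real.one_rpow]; ring
  have iM : IntegrableOn M (Ioi e) := by
    refine Integrable.congr ((ih.sub (i1 e he)).add ((i3 e he).const_mul 2)) (.of_forall fun r => ?_)
    simp only [hdec, Pi.add_apply, Pi.sub_apply]; ring
  have hMint : ∫ r in Ioi e, M r = ∫ r in Ioi e', A2 r := by
    rw [← subst_aux he (by linarith)]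
    rw [setIntegral_eq_of_subset_of_forall_sdiff_eq_zero (s := Ioo e 1) (t := Ioi e) (f := M) measurableSet_Ioi Ioo_subset_Ioi_self]
    · refine setIntegral_congr_fun measurableSet_Ioo ?_
      intro r hr
      simp only [hM]
      rw [max_eq_right (by linarith [hr.2])]
    · intro r hr
      have : 1 ≤ r := by
        by_contra hc
        exact hr.2 ⟨hr.1, not_le.1 hc⟩
      simp only [hM]
      rw [max_eq_left (by linarith), Real.zero_rpow hs0.ne', zero_mul]
  have hsplit : ∀ f : ℝ → ℝ, (∀ x > 0, IntegrableOn f (Ioi x)) →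
      ∫ r in Ioi e, f r = (∫ r in Ioc e e', f r) + ∫ r in Ioi e', f r := by
    intro f hf
    rw [← Ioc_union_Ioi_eq_Ioi hle, setIntegral_union (Ioc_disjoint_Ioi le_rfl) measurableSet_Ioi
      ((hf e he).mono_set Ioc_subset_Ioi_self) (hf e' hpos)]
  have hsum : (∫ r in Ioi e', A1 r) + ∫ r in Ioi e', A2 r = (1 / s) * ((1 + e') ^ s * e' ^ (-2 * s)) := by
    rw [← integral_add (i1 _ hpos) (i2 _ hpos)]
    exact (fA_int hs0 hpos).2
  have hA3i : ∀ x > 0, ∫ r in Ioi x, A3 r = x ^ (-2 * s) / (2 * s) := by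
    intro x hx
    rw [integral_Ioi_rpow_of_lt (by linarith) hx]
    rw [show -1 - 2 * s + 1 = -2 * s by ring]
    rw [show -2 * s = -(2 * s) by ring, div_neg, neg_div, neg_neg]
  have hG : ∫ r in Ioi e, halff s 1 r =
      (∫ r in Ioi e, A1 r) + (∫ r in Ioi e, M r) - 2 * ∫ r in Ioi e, A3 r := by
    simp_rw [hdec]
    rw [integral_sub (f := fun r => A1 r + M r) ((i1 e he).add iM) ((i3 e he).const_mul 2), integral_add (i1 e he) iM,
      integral_const_mul]
  set Q := e ^ (-2 * s) with hQ
  have hQ0 : 0 ≤ Q := by positivity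
  set m := (1 - e) ^ s with hm
  have hm0 : 0 < m := by positivity
  have hm1 : m ≤ 1 := Real.rpow_le_one h1e.le (by linarith) hs0.le
  have hm2 : 1 - e ≤ m := low_aux hs0 hs1 he.le (by linarith)
  have hQ' : e' ^ (-2 * s) = Q * m ^ 2 := by
    rw [he', Real.div_rpow he.le h1e.le, hQ, hm, ← Real.rpow_natCast, ← Real.rpow_mul h1e.le,
      div_eq_mul_inv, ← Real.rpow_neg h1e.le]
    congr 2; push_cast; ring
  have h1' : (1 + e') ^ s = m⁻¹ := by
    rw [hm, ← Real.inv_rpow h1e.le]; congr 1; rw [he']; field_simp; ring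
  have hA3c : ∫ r in Ioc e e', A3 r = Q * (1 - m ^ 2) / (2 * s) := by
    have := hsplit A3 i3
    rw [hA3i e he, hA3i e' hpos, hQ'] at this
    rw [mul_sub, sub_div, mul_one]; linarith
  have iA1c : IntegrableOn A1 (Ioc e e') := (i1 e he).mono_set Ioc_subset_Ioi_self
  have iA3c : IntegrableOn A3 (Ioc e e') := (i3 e he).mono_set Ioc_subset_Ioi_self
  have hE : |(∫ r in Ioc e e', A1 r) - ∫ r in Ioc e e', A3 r| ≤ 2 * e ^ 2 * Q := by
    rw [← integral_sub iA1c iA3c]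
    have := norm_setIntegral_le_of_norm_le_const (μ := volume) (s := Ioc e e') (C := Q)
      (f := fun r => A1 r - A3 r) (by simp) ?_
    · rw [Real.norm_eq_abs] at this
      refine this.trans ?_
      rw [Real.volume_real_Ioc_of_le hle, mul_comm]
      gcongr
      rw [he', div_sub' h1e.ne', div_le_iff₀ h1e]
      nlinarith
    · intro r hr
      have hr0 : 0 < r := he.trans hr.1
      have b1 := bern_up (r := r) hs0 hs1 (by linarith)
      have b2 : 1 ≤ (1 + r) ^ s := Real.one_le_rpow (by linarith) hs0.le
      have : A1 r - A3 r = ((1 + r) ^ s - 1) * r ^ (-1 - 2 * s) := by simp only [hA1, hA3]; ring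
      rw [this, Real.norm_of_nonneg (mul_nonneg (by linarith) (by positivity))]
      calc ((1 + r) ^ s - 1) * r ^ (-1 - 2 * s) ≤ r * r ^ (-1 - 2 * s) := by
            gcongr; nlinarith
        _ = r ^ (-2 * s) := by
            rw [mul_comm, ← Real.rpow_add_one hr0.ne']; ring_nf
        _ ≤ Q := Real.rpow_le_rpow_of_nonpos he hr.1.le (by linarith)
  have hfin : ∫ r in Ioi e, halff s 1 r = ((∫ r in Ioc e e', A1 r) - ∫ r in Ioc e e', A3 r)
      - Q * (1 - m) ^ 2 / (2 * s) := by
    rw [hG, hMint, hsplit A1 i1, hA3i e he, hA3c]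
    rw [hQ', h1'] at hsum
    have : (∫ r in Ioi e', A2 r) = 1 / s * (m⁻¹ * (Q * m ^ 2)) - (∫ r in Ioi e', A1 r) := by linarith
    rw [this, ← hQ]
    clear_value Q
    field_simp
    ring
  have hQe : e ^ (2 - 2 * s) = e ^ 2 * Q := by
    rw [hQ, ← Real.rpow_natCast, ← Real.rpow_add he]; congr 1; push_cast; ring
  rw [hfin, hQe]
  refine (abs_sub _ _).trans ?_
  have h5 : |Q * (1 - m) ^ 2 / (2 * s)| ≤ 1 / (2 * s) * (e ^ 2 * Q) := by
    rw [abs_of_nonneg (by positivity), div_eq_mul_inv, one_div, mul_comm, mul_comm (e ^ 2)]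
    gcongr
    linarith
  linarith

lemma halff_zero {s : ℝ} (hs0 : 0 < s) (hs1 : s < 1) : ∫ r in Ioi 0, halff s 1 r = 0 := by
  set K := 2 / (2 - 2 * s) + (1 / (2 * s) + 2)
  have key : ∀ e ∈ Ioc (0 : ℝ) (1 / 2), |∫ r in Ioi 0, halff s 1 r| ≤ K * e ^ (2 - 2 * s) := by
    rintro e ⟨he, he1⟩
    have ih := halff_int hs0 hs1
    rw [← Ioc_union_Ioi_eq_Ioi he.le, setIntegral_union (Ioc_disjoint_Ioi le_rfl) measurableSet_Ioi
      (ih.mono_set Ioc_subset_Ioi_self) (ih.mono_set (Ioi_subset_Ioi he.le))]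
    have h1 := tail_bound hs0 hs1 he he1
    have h2 : |∫ r in Ioc 0 e, halff s 1 r| ≤ 2 / (2 - 2 * s) * e ^ (2 - 2 * s) := by
      have hi : IntegrableOn (fun r : ℝ => 2 * r ^ (1 - 2 * s)) (Ioc 0 e) := by
        have := (intervalIntegral.intervalIntegrable_rpow' (a := 0) (b := e) (r := 1 - 2 * s) (by linarith))
        rw [intervalIntegrable_iff_integrableOn_Ioc_of_le he.le] at this
        exact this.const_mul 2
      have := norm_integral_le_of_norm_le hi (f := halff s 1)
        ((ae_restrict_iff' measurableSet_Ioc).2 (.of_forall fun r hr => 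
          halff_le1 hs0 hs1 hr.1 (by linarith [hr.2])))
      refine this.trans (le_of_eq ?_)
      rw [← intervalIntegral.integral_of_le he.le, intervalIntegral.integral_const_mul,
        integral_rpow (Or.inl (by linarith)), show 1 - 2 * s + 1 = 2 - 2 * s by ring,
        Real.zero_rpow (by linarith)]
      ring
    refine (abs_add_le _ _).trans ?_
    rw [add_mul]; linarith
  have hlim : Filter.Tendsto (fun e : ℝ => K * e ^ (2 - 2 * s)) (nhdsWithin 0 (Ioi 0)) (nhds 0) := by
    have : ContinuousAt (fun e : ℝ => K * e ^ (2 - 2 * s)) 0 :=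
      continuousAt_const.mul (Real.continuousAt_rpow_const _ _ (Or.inr (by linarith)))
    have h := this.tendsto.mono_left (nhdsWithin_le_nhds (s := Ioi 0))
    simpa [Real.zero_rpow (show 2 - 2 * s ≠ 0 by linarith)] using h
  have : |∫ r in Ioi 0, halff s 1 r| ≤ 0 := by
    refine ge_of_tendsto hlim ?_
    filter_upwards [Ioc_mem_nhdsGT (show (0 : ℝ) < 1 / 2 by norm_num)] with e he using key e he
  exact abs_nonpos_iff.1 this

lemma halff_scale {s a r : ℝ} (ha : 0 < a) (hr : 0 < r) :
    halff s a (a * r) = a ^ (-1 - s) * halff s 1 r := by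
  unfold halff
  have h1 : (a + a * r) = a * (1 + r) := by ring
  have h2 : max 0 (a - a * r) = a * max 0 (1 - r) := by
    rw [mul_max_of_nonneg _ _ ha.le]; ring_nf
  rw [h1, h2, Real.mul_rpow ha.le (by linarith), Real.mul_rpow ha.le (by simp), Real.mul_rpow ha.le hr.le,
    Real.one_rpow, show -1 - s = s + (-1 - 2 * s) by ring, Real.rpow_add ha]
  ring

lemma halff_a {s a : ℝ} (hs0 : 0 < s) (hs1 : s < 1) (ha : 0 < a) :
    IntegrableOn (halff s a) (Ioi 0) ∧ ∫ r in Ioi 0, halff s a r = 0 := by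
  constructor
  · have := integrableOn_Ioi_comp_mul_left_iff (halff s a) 0 ha
    rw [mul_zero] at this
    rw [← this]
    refine IntegrableOn.congr_fun ((halff_int hs0 hs1).const_mul (a ^ (-1 - s))) ?_ measurableSet_Ioi
    intro r hr
    exact (halff_scale ha hr).symm
  · have := integral_comp_mul_left_Ioi (halff s a) 0 ha
    rw [mul_zero, setIntegral_congr_fun measurableSet_Ioi (fun r hr => halff_scale ha hr),
      integral_const_mul, halff_zero hs0 hs1, mul_zero] at this
    have h := this.symm
    rw [smul_eq_mul, mul_eq_zero] at h
    exact h.resolve_left (inv_ne_zero ha.ne')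

/-- interval integrand -/
def intf (s A B r : ℝ) : ℝ :=
  ((max 0 ((A - r) * (B + r))) ^ s + (max 0 ((A + r) * (B - r))) ^ s - 2 * (A * B) ^ s)
    * r ^ (-1 - 2 * s)

lemma intf_sub {s a r : ℝ} (hs0 : 0 < s) (hs1 : s < 1) (ha : 0 < a) (ha1 : a ≤ 1) (hr : 0 < r) :
    |intf s a 1 r - halff s a r| ≤ 4 * domf s r := by
  have has : a ^ s ≤ 1 := Real.rpow_le_one ha.le ha1 hs0.le
  have has0 : 0 < a ^ s := by positivity
  unfold domf
  split_ifs with h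
  · have e1 : max 0 ((a - r) * (1 + r)) = max 0 (a - r) * (1 + r) := by
      rw [max_mul_of_nonneg _ _ (by linarith), zero_mul]
    have e2 : max 0 ((a + r) * (1 - r)) = (a + r) * (1 - r) := 
      max_eq_right (mul_nonneg (by linarith) (by linarith))
    unfold intf halff
    rw [e1, e2, Real.mul_rpow (by simp) (by linarith), Real.mul_rpow (by linarith) (by linarith), mul_one]
    have h1 := holder_aux hs0 hs1 (x := a + r) (y := a) (by linarith) ha.le
    have h2 := holder_aux hs0 hs1 (x := max 0 (a - r)) (y := a) (by simp) ha.le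
    rw [add_sub_cancel_left, abs_of_pos hr] at h1
    have h3 : |max 0 (a - r) - a| ≤ r := by
      rcases max_cases 0 (a - r) with h | h <;> rw [h.1, abs_le] <;> constructor <;> linarith
    replace h2 := h2.trans (Real.rpow_le_rpow (abs_nonneg _) h3 hs0.le)
    have h4 := secdiff hs0 hs1 hr.le h
    obtain ⟨h5, h6⟩ := lip_aux hs0 hs1 hr.le h
    set pm := max 0 (a - r) ^ s
    set pp := (a + r) ^ s
    set qp := (1 + r) ^ s
    set qm := (1 - r) ^ s
    have e3 : (pm * qp + pp * qm - 2 * a ^ s) * r ^ (-1 - 2 * s) - (pp + pm - 2 * a ^ s) * r ^ (-1 - 2 * s)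
      = (a ^ s * (qp + qm - 2) + (pm - a ^ s) * (qp - 1) + (pp - a ^ s) * (qm - 1)) * r ^ (-1 - 2 * s) := by ring
    have e4 : r ^ (-s) = (r ^ s * r) * r ^ (-1 - 2 * s) := by
      rw [← Real.rpow_add_one hr.ne', ← Real.rpow_add hr]; ring_nf
    rw [e3, abs_mul, abs_of_nonneg (Real.rpow_nonneg hr.le (-1 - 2 * s)), e4, ← mul_assoc]
    gcongr
    have h7 : r ≤ r ^ s := by
      have := low_aux (r := 1 - r) hs0 hs1 (by linarith) (by linarith)
      simpa using this
    have b1 : |a ^ s * (qp + qm - 2)| ≤ 2 * (r ^ s * r) := by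
      rw [abs_mul, abs_of_pos has0]
      calc a ^ s * |qp + qm - 2| ≤ 1 * (2 * r ^ 2) := by gcongr
        _ ≤ _ := by nlinarith
    have b2 : |(pm - a ^ s) * (qp - 1)| ≤ r ^ s * r := by rw [abs_mul]; gcongr
    have b3 : |(pp - a ^ s) * (qm - 1)| ≤ r ^ s * r := by rw [abs_mul]; gcongr
    calc _ ≤ _ := abs_add_three _ _ _
      _ ≤ 2 * (r ^ s * r) + (r ^ s * r) + (r ^ s * r) := by gcongr
      _ = _ := by ring
  · push Not at h
    have h2 := halff_le2 hs0 hs1 ha hr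
    have : |intf s a 1 r| ≤ 2 * r ^ (-1 - s) := by
      unfold intf
      rw [max_eq_left (by nlinarith), max_eq_left (by nlinarith), Real.zero_rpow hs0.ne', mul_one, abs_mul,
        abs_of_nonneg (Real.rpow_nonneg hr.le (-1 - 2 * s))]
      gcongr
      · rw [zero_add, zero_sub, abs_neg, abs_of_pos (by positivity)]; linarith
      · exact h.le
      · linarith
    refine (abs_sub _ _).trans (by linarith)

lemma intf_bound1 {s a : ℝ} (hs0 : 0 < s) (hs1 : s < 1) (ha : 0 < a) (ha1 : a ≤ 1) :
    |∫ r in Ioi 0, intf s a 1 r| ≤ ∫ r in Ioi 0, 4 * domf s r := by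
  have hd := (domf_int hs0 hs1).const_mul 4
  have hb : ∀ᵐ r ∂(volume.restrict (Ioi (0 : ℝ))), ‖intf s a 1 r - halff s a r‖ ≤ 4 * domf s r :=
    (ae_restrict_iff' measurableSet_Ioi).2 (.of_forall fun r hr => intf_sub hs0 hs1 ha ha1 hr)
  have hm : Measurable (intf s a 1) := by unfold intf; fun_prop
  obtain ⟨hi, h0⟩ := halff_a hs0 hs1 ha
  have hi2 : IntegrableOn (fun r => intf s a 1 r - halff s a r) (Ioi 0) :=
    Integrable.mono' hd (hm.sub (halff_meas s a)).aestronglyMeasurable hb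
  have : ∫ r in Ioi 0, intf s a 1 r = ∫ r in Ioi 0, (intf s a 1 r - halff s a r) := by
    have h := integral_add hi2 hi
    rw [h0, add_zero] at h
    rw [← h]
    simp
  rw [this]
  exact norm_integral_le_of_norm_le hd hb

lemma intf_bound {s A B : ℝ} (hs0 : 0 < s) (hs1 : s < 1) (hA : 0 < A) (hB : 0 < B) :
    |∫ r in Ioi 0, intf s A B r| ≤ ∫ r in Ioi 0, 4 * domf s r := by
  wlog h : A ≤ B generalizing A B
  · have h1 := this hB hA (le_of_not_ge h)
    have : intf s A B = intf s B A := by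
      ext r; unfold intf
      rw [add_comm ((max 0 _) ^ s), mul_comm (A + r), mul_comm (A - r), mul_comm A]
    rwa [this]
  have ha1 : A / B ≤ 1 := (div_le_one hB).2 h
  have ha : 0 < A / B := div_pos hA hB
  refine le_of_eq_of_le ?_ (intf_bound1 hs0 hs1 ha ha1)
  have hsc : ∀ r ∈ Ioi (0 : ℝ), intf s A B (B * r) = B⁻¹ * intf s (A / B) 1 r := by
    intro r hr
    have hr : 0 < r := hr
    unfold intf
    have e1 : max 0 ((A - B * r) * (B + B * r)) = (B * B) * max 0 ((A / B - r) * (1 + r)) := by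
      rw [mul_max_of_nonneg _ _ (by positivity)]; congr 1; ring; field_simp
    have e2 : max 0 ((A + B * r) * (B - B * r)) = (B * B) * max 0 ((A / B + r) * (1 - r)) := by
      rw [mul_max_of_nonneg _ _ (by positivity)]; congr 1; ring; field_simp
    have e3 : A * B = (B * B) * (A / B * 1) := by field_simp
    have hm : ∀ y : ℝ, 0 ≤ y → ((B * B) * y) ^ s = (B * B) ^ s * y ^ s := fun y hy =>
      Real.mul_rpow (by positivity) hy
    rw [e1, e2, e3, hm _ (le_max_left _ _), hm _ (le_max_left _ _), hm _ (by positivity),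
      Real.mul_rpow hB.le hr.le]
    have e4 : (B * B) ^ s * B ^ (-1 - 2 * s) = B⁻¹ := by
      rw [Real.mul_rpow hB.le hB.le, ← Real.rpow_add hB, ← Real.rpow_add hB, ← Real.rpow_neg_one]
      ring_nf
    rw [← e4]
    ring
  have := integral_comp_mul_left_Ioi (intf s A B) 0 hB
  rw [mul_zero, setIntegral_congr_fun measurableSet_Ioi hsc,
      integral_const_mul, smul_eq_mul] at this
  rw [mul_left_cancel₀ (inv_ne_zero hB.ne') this]

lemma polar_bound {d : ℕ} (hd : 2 ≤ d) (f : EuclideanSpace ℝ (Fin d) → ℝ) (C : ℝ)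
    (hf : Integrable f)
    (hC : ∀ θ : EuclideanSpace ℝ (Fin d), ‖θ‖ = 1 → |∫ r in Ioi (0 : ℝ), r ^ (d - 1) * f (r • θ)| ≤ C) :
    |∫ z, f z| ≤ C * (volume : Measure (EuclideanSpace ℝ (Fin d))).toSphere.real univ := by
  set μ := (volume : Measure (EuclideanSpace ℝ (Fin d)))
  have hdim : Module.finrank ℝ (EuclideanSpace ℝ (Fin d)) = d := by simp
  have : Nontrivial (EuclideanSpace ℝ (Fin d)) :=
    Module.nontrivial_of_finrank_pos (R := ℝ) (by rw [hdim]; omega)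
  have h1 : ∫ z, f z ∂μ = ∫ p, f ((p.2 : ℝ) • (p.1 : EuclideanSpace ℝ (Fin d)))
      ∂μ.toSphere.prod (.volumeIoiPow (Module.finrank ℝ (EuclideanSpace ℝ (Fin d)) - 1)) := by
    have := μ.measurePreserving_homeomorphUnitSphereProd.integral_comp
        (homeomorphUnitSphereProd (EuclideanSpace ℝ (Fin d))).measurableEmbedding (fun p : sphere (0 : EuclideanSpace ℝ (Fin d)) 1 × Ioi (0 : ℝ) => f ((p.2 : ℝ) • (p.1 : EuclideanSpace ℝ (Fin d))))
    rw [← this]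
    have h0 : ∫ z, f z ∂μ = ∫ z : ({0}ᶜ : Set (EuclideanSpace ℝ (Fin d))), f z ∂(μ.comap (↑)) := by
      rw [integral_subtype_comap (measurableSet_singleton (0 : EuclideanSpace ℝ (Fin d))).compl f,
        restrict_compl_singleton]
    rw [h0]
    congr 1
    ext z
    have hz : ‖(z : EuclideanSpace ℝ (Fin d))‖ ≠ 0 := norm_ne_zero_iff.2 z.2
    simp [smul_smul, hz]
  have h2 : Integrable (fun p : sphere (0 : EuclideanSpace ℝ (Fin d)) 1 × Ioi (0 : ℝ) =>
        f ((p.2 : ℝ) • (p.1 : EuclideanSpace ℝ (Fin d))))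
      (μ.toSphere.prod (.volumeIoiPow (Module.finrank ℝ (EuclideanSpace ℝ (Fin d)) - 1))) := by
    rw [← μ.measurePreserving_homeomorphUnitSphereProd.integrable_comp_emb
        (homeomorphUnitSphereProd (EuclideanSpace ℝ (Fin d))).measurableEmbedding]
    have : Integrable (fun z : ({0}ᶜ : Set (EuclideanSpace ℝ (Fin d))) => f z) (μ.comap (↑)) := by
      have := (integrableOn_iff_comap_subtypeVal (μ := μ) (f := f) (s := {0}ᶜ) (measurableSet_singleton _).compl).1
        hf.integrableOn
      exact this
    refine this.congr (.of_forall fun z => ?_)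
    have hz : ‖(z : EuclideanSpace ℝ (Fin d))‖ ≠ 0 := norm_ne_zero_iff.2 z.2
    simp [smul_smul, hz]
  rw [h1, integral_prod _ h2]
  have := norm_integral_le_of_norm_le_const (μ := μ.toSphere) (C := C) 
    (f := fun θ : sphere (0 : EuclideanSpace ℝ (Fin d)) 1 => ∫ r : Ioi (0 : ℝ), f ((r : ℝ) • (θ : EuclideanSpace ℝ (Fin d))) 
      ∂(.volumeIoiPow (Module.finrank ℝ (EuclideanSpace ℝ (Fin d)) - 1))) ?_
  · exact this
  · refine .of_forall fun θ => ?_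
    have hθ : ‖(θ : EuclideanSpace ℝ (Fin d))‖ = 1 := by simp
    refine le_of_eq_of_le ?_ (hC θ hθ)
    rw [Real.norm_eq_abs]
    congr 1
    simp only [Measure.volumeIoiPow, ENNReal.ofReal]
    rw [integral_withDensity_eq_integral_smul,
        integral_subtype_comap measurableSet_Ioi fun a ↦ Real.toNNReal (a ^ (Module.finrank ℝ (EuclideanSpace ℝ (Fin d)) - 1)) • f (a • (θ : EuclideanSpace ℝ (Fin d))),
        setIntegral_congr_fun measurableSet_Ioi fun x hx ↦ ?_]
    · rw [hdim, NNReal.smul_def, Real.coe_toNNReal _ (pow_nonneg hx.out.le _), smul_eq_mul]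
    · exact (measurable_subtype_coe.pow_const _).real_toNNReal

/-- torsion-type function -/
def uf {d : ℕ} (s : ℝ) (y : EuclideanSpace ℝ (Fin d)) : ℝ := (max 0 (1 - ‖y‖ ^ 2)) ^ s

lemma uf_cont {d : ℕ} {s : ℝ} (hs0 : 0 < s) : Continuous (uf (d := d) s) := by
  unfold uf
  refine Continuous.rpow_const (by fun_prop) (fun _ => Or.inr hs0.le)

lemma uf_nonneg {d : ℕ} {s : ℝ} (y : EuclideanSpace ℝ (Fin d)) : 0 ≤ uf s y :=
  Real.rpow_nonneg (le_max_left _ _) _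

lemma uf_le_one {d : ℕ} {s : ℝ} (hs0 : 0 < s) (y : EuclideanSpace ℝ (Fin d)) : uf s y ≤ 1 :=
  Real.rpow_le_one (le_max_left _ _) (max_le zero_le_one (by linarith [sq_nonneg ‖y‖])) hs0.le

lemma uf_holder {d : ℕ} {s : ℝ} (hs0 : 0 < s) (hs1 : s < 1) (x z : EuclideanSpace ℝ (Fin d))
    (hx : ‖x‖ < 1) (hz : ‖z‖ ≤ 1) : |uf s (x + z) - uf s x| ≤ 3 * ‖z‖ ^ s := by
  unfold uf
  refine (holder_aux hs0 hs1 (le_max_left _ _) (le_max_left _ _)).trans ?_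
  have h1 : |max 0 (1 - ‖x + z‖ ^ 2) - max 0 (1 - ‖x‖ ^ 2)| ≤ 3 * ‖z‖ := by
    have h := abs_max_sub_max_le_max 0 (1 - ‖x + z‖ ^ 2) 0 (1 - ‖x‖ ^ 2)
    refine h.trans (max_le (by simp) ?_)
    have a1 := norm_add_le x z
    have a2 : |‖x + z‖ - ‖x‖| ≤ ‖z‖ := by simpa using abs_norm_sub_norm_le (x + z) x
    have a3 : (1 - ‖x + z‖ ^ 2) - (1 - ‖x‖ ^ 2) = -((‖x + z‖ - ‖x‖) * (‖x + z‖ + ‖x‖)) := by ring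
    have a4 := norm_nonneg (x + z)
    have a5 := norm_nonneg x
    rw [a3, abs_neg, abs_mul, abs_of_nonneg (by linarith : 0 ≤ ‖x + z‖ + ‖x‖), mul_comm]
    gcongr
    linarith
  calc _ ≤ (3 * ‖z‖) ^ s := Real.rpow_le_rpow (abs_nonneg _) h1 hs0.le
    _ = 3 ^ s * ‖z‖ ^ s := Real.mul_rpow (by norm_num) (norm_nonneg _)
    _ ≤ 3 * ‖z‖ ^ s := by
      gcongr
      calc (3 : ℝ) ^ s ≤ 3 ^ (1 : ℝ) := Real.rpow_le_rpow_of_exponent_le (by norm_num) hs1.le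
        _ = 3 := by simp

lemma uf_bound {d : ℕ} (hd : 2 ≤ d) {s : ℝ} (hs0 : 0 < s) (hs1 : s < 1) (x : EuclideanSpace ℝ (Fin d))
    (hx : ‖x‖ < 1) 
    (hi : Integrable (fun z => (uf s (x + z) + uf s (x - z) - 2 * uf s x) * ‖z‖ ^ (-(d : ℝ) - 2 * s))) :
    |∫ z, (uf s (x + z) + uf s (x - z) - 2 * uf s x) * ‖z‖ ^ (-(d : ℝ) - 2 * s)| ≤ 
     (∫ r in Ioi 0, 4 * domf s r) * (volume : Measure (EuclideanSpace ℝ (Fin d))).toSphere.real univ := by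
  refine polar_bound hd _ _ hi ?_
  intro θ hθ
  set b := ⟪x, θ⟫ with hb
  set R := √(1 - ‖x‖ ^ 2 + b ^ 2) with hR
  have hx2 : 0 < 1 - ‖x‖ ^ 2 := by nlinarith [norm_nonneg x]
  have hR2 : R ^ 2 = 1 - ‖x‖ ^ 2 + b ^ 2 := Real.sq_sqrt (by positivity)
  have hbR : |b| < R := by
    rw [← Real.sqrt_sq_eq_abs]; exact Real.sqrt_lt_sqrt (by positivity) (by linarith)
  rw [abs_lt] at hbR
  refine le_of_eq_of_le ?_ (intf_bound (A := R - b) (B := R + b) hs0 hs1 (by linarith) (by linarith))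
  congr 1
  refine setIntegral_congr_fun measurableSet_Ioi ?_
  intro r hr
  have hr : 0 < r := hr
  simp only
  unfold intf uf
  have n1 : ‖x + r • θ‖ ^ 2 = ‖x‖ ^ 2 + 2 * r * b + r ^ 2 := by
    rw [norm_add_sq_real, inner_smul_right, norm_smul, hθ, ← hb, Real.norm_eq_abs, mul_one, sq_abs]; ring
  have n2 : ‖x - r • θ‖ ^ 2 = ‖x‖ ^ 2 - 2 * r * b + r ^ 2 := by
    rw [norm_sub_sq_real, inner_smul_right, norm_smul, hθ, ← hb, Real.norm_eq_abs, mul_one, sq_abs]; ring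
  have n3 : ‖r • θ‖ = r := by rw [norm_smul, hθ, Real.norm_of_nonneg hr.le, mul_one]
  have e1 : 1 - ‖x + r • θ‖ ^ 2 = (R - b - r) * (R + b + r) := by rw [n1]; linear_combination -hR2
  have e2 : 1 - ‖x - r • θ‖ ^ 2 = (R - b + r) * (R + b - r) := by rw [n2]; linear_combination -hR2
  have e3 : max 0 (1 - ‖x‖ ^ 2) = (R - b) * (R + b) := by
    rw [max_eq_right hx2.le]; linear_combination -hR2
  rw [e1, e2, e3, n3]
  have e4 : r ^ (-1 - 2 * s) = r ^ (d - 1) * r ^ (-(d : ℝ) - 2 * s) := by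
    rw [← Real.rpow_natCast, ← Real.rpow_add hr]; congr 1
    rw [Nat.cast_sub (by omega)]; push_cast; ring
  rw [e4]
  ring

lemma dom_int {d : ℕ} (hd : 2 ≤ d) {s : ℝ} (hs0 : 0 < s) (hs1 : s < 1) :
    Integrable (fun z : EuclideanSpace ℝ (Fin d) => domf s ‖z‖ * ‖z‖ ^ (1 - (d : ℝ))) := by
  have hdim : Module.finrank ℝ (EuclideanSpace ℝ (Fin d)) = d := by simp
  have : Nontrivial (EuclideanSpace ℝ (Fin d)) :=
    Module.nontrivial_of_finrank_pos (R := ℝ) (by rw [hdim]; omega)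
  rw [integrable_fun_norm_addHaar volume (f := fun r => domf s r * r ^ (1 - (d : ℝ))), hdim]
  refine (domf_int hs0 hs1).congr_fun ?_ measurableSet_Ioi
  intro r hr
  have hr : 0 < r := hr
  have : r ^ (d - 1) * r ^ (1 - (d : ℝ)) = 1 := by
    rw [← Real.rpow_natCast, ← Real.rpow_add hr, Nat.cast_sub (by omega)]; simp
  simp only [smul_eq_mul]
  linear_combination -(domf s r) * this

lemma lam_in {d : ℕ} (x z : EuclideanSpace ℝ (Fin d)) (h : ‖x + z‖ ≤ 1) :
    Lam (ball (0 : EuclideanSpace ℝ (Fin d)) 1) x (x + z) = x + z := by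
  have : lamT (ball (0 : EuclideanSpace ℝ (Fin d)) 1) x (x + z) = 1 := by
    unfold lamT
    refine IsGreatest.csSup_eq ⟨⟨by simp, ?_⟩, fun t ht => ht.1.2⟩
    rw [closure_ball _ one_ne_zero]
    simpa using h
  simp [Lam, this]

lemma lam_out {d : ℕ} (x z : EuclideanSpace ℝ (Fin d)) (hx : ‖x‖ < 1) (h : 1 < ‖x + z‖) :
    ‖Lam (ball (0 : EuclideanSpace ℝ (Fin d)) 1) x (x + z)‖ = 1 := by
  unfold Lam
  set S := {t : ℝ | t ∈ Icc (0 : ℝ) 1 ∧ x + t • (x + z - x) ∈ closure (ball (0 : EuclideanSpace ℝ (Fin d)) 1)} with hS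
  have hl : lamT (ball (0 : EuclideanSpace ℝ (Fin d)) 1) x (x + z) = sSup S := rfl
  rw [hl]
  have hcont : Continuous fun t : ℝ => x + t • (x + z - x) := by fun_prop
  have hcl : IsClosed S := isClosed_Icc.inter (isClosed_closure.preimage hcont)
  have hbd : BddAbove S := ⟨1, fun t ht => ht.1.2⟩
  have hne : S.Nonempty := ⟨0, by simp, subset_closure (by simpa using hx)⟩
  have hmem := hcl.csSup_mem hne hbd
  set t := sSup S with ht
  have h1 : ‖x + t • (x + z - x)‖ ≤ 1 := by
    have := hmem.2
    rw [closure_ball _ one_ne_zero] at this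
    simpa using this
  refine le_antisymm h1 ?_
  -- intermediate value on [t,1]
  have hiv := intermediate_value_Icc hmem.1.2 (f := fun t : ℝ => ‖x + t • (x + z - x)‖) hcont.norm.continuousOn
  have h1m : (1 : ℝ) ∈ Icc (‖x + t • (x + z - x)‖) (‖x + (1 : ℝ) • (x + z - x)‖) := by
    refine ⟨h1, ?_⟩
    simpa using h.le
  obtain ⟨r, hr, hr1⟩ := hiv h1m
  simp only at hr1
  have hrS : r ∈ S := by
    refine ⟨⟨hmem.1.1.trans hr.1, hr.2⟩, ?_⟩
    rw [closure_ball _ one_ne_zero]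
    simpa using hr1.le
  have : r = t := le_antisymm (le_csSup hbd hrS) hr.1
  rw [← this, hr1]

/-- quotient function -/
def gf {d : ℕ} (s : ℝ) (φ : EuclideanSpace ℝ (Fin d) → ℝ) (y : EuclideanSpace ℝ (Fin d)) : ℝ :=
  if ‖y‖ ≤ 3 / 4 then φ y / uf s y else (1 + ‖y‖) ^ (-s)

section
variable {d : ℕ} {s : ℝ} {φ : EuclideanSpace ℝ (Fin d) → ℝ}

lemma uf_pos {y : EuclideanSpace ℝ (Fin d)} (hy : ‖y‖ < 1) : 0 < uf s y := by
  unfold uf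
  rw [max_eq_right (by nlinarith [norm_nonneg y])]
  exact Real.rpow_pos_of_pos (by nlinarith [norm_nonneg y]) _

lemma gf_quot (hb : ∀ y : EuclideanSpace ℝ (Fin d), ‖y‖ ≤ 1 → 1 - ‖y‖ ≤ 1 / 2 → φ y = (1 - ‖y‖) ^ s)
    {y : EuclideanSpace ℝ (Fin d)} (hy1 : 1 / 2 ≤ ‖y‖) (hy : ‖y‖ < 1) :
    φ y / uf s y = (1 + ‖y‖) ^ (-s) := by
  rw [div_eq_iff (uf_pos hy).ne', hb y hy.le (by linarith)]
  unfold uf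
  rw [max_eq_right (by nlinarith [norm_nonneg y]), show 1 - ‖y‖ ^ 2 = (1 + ‖y‖) * (1 - ‖y‖) by ring,
    Real.mul_rpow (by linarith) (by linarith), ← mul_assoc, ← Real.rpow_add (by linarith)]
  simp

lemma gf_in (hb : ∀ y : EuclideanSpace ℝ (Fin d), ‖y‖ ≤ 1 → 1 - ‖y‖ ≤ 1 / 2 → φ y = (1 - ‖y‖) ^ s)
    {y : EuclideanSpace ℝ (Fin d)} (hy : ‖y‖ < 1) : gf s φ y = φ y / uf s y := by
  unfold gf
  split_ifs with h
  · rfl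
  · exact (gf_quot hb (by linarith) hy).symm

lemma gf_out (hb : ∀ y : EuclideanSpace ℝ (Fin d), ‖y‖ ≤ 1 → 1 - ‖y‖ ≤ 1 / 2 → φ y = (1 - ‖y‖) ^ s)
    {y : EuclideanSpace ℝ (Fin d)} (hy : 1 / 2 ≤ ‖y‖) : gf s φ y = (1 + ‖y‖) ^ (-s) := by
  unfold gf
  split_ifs with h
  · exact gf_quot hb hy (by linarith)
  · rfl

lemma gf_smooth (hb : ∀ y : EuclideanSpace ℝ (Fin d), ‖y‖ ≤ 1 → 1 - ‖y‖ ≤ 1 / 2 → φ y = (1 - ‖y‖) ^ s)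
    (h2 : ContDiffOn ℝ 2 φ (ball (0 : EuclideanSpace ℝ (Fin d)) 1)) : ContDiff ℝ 2 (gf s φ) := by
  rw [contDiff_iff_contDiffAt]
  intro y
  by_cases hy : ‖y‖ < 1
  · have hnh : ball (0 : EuclideanSpace ℝ (Fin d)) 1 ∈ nhds y := isOpen_ball.mem_nhds (by simpa using hy)
    have hpos : 1 - ‖y‖ ^ 2 ≠ 0 := by nlinarith [norm_nonneg y]
    have hu : ContDiffAt ℝ 2 (fun y : EuclideanSpace ℝ (Fin d) => (1 - ‖y‖ ^ 2) ^ s) y := by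
      refine ContDiffAt.rpow_const_of_ne ?_ hpos
      exact contDiffAt_const.sub (contDiff_norm_sq ℝ).contDiffAt
    have hu0 : (1 - ‖y‖ ^ 2) ^ s ≠ 0 := (Real.rpow_pos_of_pos (by nlinarith [norm_nonneg y]) _).ne'
    have := (h2.contDiffAt hnh).div hu hu0
    refine this.congr_of_eventuallyEq ?_
    filter_upwards [hnh] with w hw
    have hw : ‖w‖ < 1 := by simpa using hw
    rw [gf_in hb hw]
    unfold uf
    rw [max_eq_right (by nlinarith [norm_nonneg w])]
    rfl
  · push Not at hy
    have hy0 : y ≠ 0 := by rintro rfl; simp at hy; linarith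
    have : ContDiffAt ℝ 2 (fun y : EuclideanSpace ℝ (Fin d) => (1 + ‖y‖) ^ (-s)) y := by
      refine ContDiffAt.rpow_const_of_ne ?_ (by linarith)
      exact contDiffAt_const.add (contDiffAt_norm ℝ hy0)
    refine this.congr_of_eventuallyEq ?_
    have : ∀ᶠ w : EuclideanSpace ℝ (Fin d) in nhds y, 1 / 2 < ‖w‖ :=
      continuous_norm.continuousAt.eventually_const_lt (by linarith)
    filter_upwards [this] with w hw using gf_out hb hw.le

lemma gf_bdd (hs0 : 0 < s) (hb : ∀ y : EuclideanSpace ℝ (Fin d), ‖y‖ ≤ 1 → 1 - ‖y‖ ≤ 1 / 2 → φ y = (1 - ‖y‖) ^ s)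
    (hc : Continuous (gf s φ)) : ∃ M : ℝ, ∀ y, |gf s φ y| ≤ M := by
  obtain ⟨M, hM⟩ := (isCompact_closedBall (0 : EuclideanSpace ℝ (Fin d)) 1).exists_bound_of_continuousOn hc.continuousOn
  refine ⟨max M 1, fun y => ?_⟩
  by_cases hy : ‖y‖ ≤ 1
  · exact (hM y (by simpa using hy)).trans (le_max_left _ _)
  · push Not at hy
    rw [gf_out hb (by linarith), abs_of_nonneg (by positivity)]
    refine le_trans ?_ (le_max_right _ _)
    exact Real.rpow_le_one_of_one_le_of_nonpos (by linarith) (by linarith)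

lemma phi_eq (hs0 : 0 < s) (hb : ∀ y : EuclideanSpace ℝ (Fin d), ‖y‖ ≤ 1 → 1 - ‖y‖ ≤ 1 / 2 → φ y = (1 - ‖y‖) ^ s)
    (x z : EuclideanSpace ℝ (Fin d)) (hx : ‖x‖ < 1) :
    φ (Lam (ball (0 : EuclideanSpace ℝ (Fin d)) 1) x (x + z)) = uf s (x + z) * gf s φ (x + z) := by
  have hφ1 : ∀ y : EuclideanSpace ℝ (Fin d), ‖y‖ = 1 → φ y = 0 := by
    intro y hy
    rw [hb y hy.le (by rw [hy]; norm_num), hy, sub_self, Real.zero_rpow hs0.ne']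
  have hu1 : ∀ y : EuclideanSpace ℝ (Fin d), 1 ≤ ‖y‖ → uf s y = 0 := by
    intro y hy
    unfold uf
    rw [max_eq_left (by nlinarith), Real.zero_rpow hs0.ne']
  rcases lt_trichotomy ‖x + z‖ 1 with h | h | h
  · rw [lam_in x z h.le, gf_in hb h, mul_div_cancel₀ _ (uf_pos h).ne']
  · rw [lam_in x z h.le, hφ1 _ h, hu1 _ h.ge, zero_mul]
  · rw [hφ1 _ (lam_out x z hx h), hu1 _ h.le, zero_mul]
end

lemma taylor_aux {E : Type*} [NormedAddCommGroup E] [NormedSpace ℝ E] [FiniteDimensional ℝ E]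
    (g : E → ℝ) (hg : ContDiff ℝ 2 g) :
    ∃ C : ℝ, 0 ≤ C ∧ ∀ x z : E, ‖x‖ < 1 → ‖z‖ ≤ 1 → |g (x + z) - g x| ≤ C * ‖z‖ ∧
      |g (x + z) + g (x - z) - 2 * g x| ≤ C * ‖z‖ ^ 2 := by
  have : ProperSpace E := FiniteDimensional.proper_real E
  have hK := isCompact_closedBall (0 : E) 2
  have hf' : ContDiff ℝ 1 (fderiv ℝ g) := hg.fderiv_right (by norm_num)
  obtain ⟨K1, hK1⟩ := (hf'.locallyLipschitz.locallyLipschitzOn (s := closedBall 0 2)).exists_lipschitzOnWith_of_compact hK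
  obtain ⟨K2, hK2⟩ := ((hg.of_le (by norm_num : (1 : WithTop ℕ∞) ≤ 2)).locallyLipschitz.locallyLipschitzOn (s := closedBall 0 2)).exists_lipschitzOnWith_of_compact hK
  have hT : ∀ x z : E, ‖x‖ < 1 → ‖z‖ ≤ 1 → |g (x + z) - g x - fderiv ℝ g x z| ≤ K1 * ‖z‖ ^ 2 := by
    intro x z hx hz
    have hsub : closedBall x ‖z‖ ⊆ closedBall (0 : E) 2 := by
      refine closedBall_subset_closedBall' ?_
      rw [dist_zero_right]; linarith
    have := Convex.norm_image_sub_le_of_norm_hasFDerivWithin_le' (𝕜 := ℝ) (f := g) (f' := fderiv ℝ g)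
      (φ := fderiv ℝ g x) (C := K1 * ‖z‖) (s := closedBall x ‖z‖) (x := x) (y := x + z)
      (fun w _ => (hg.differentiable (by norm_num) w).hasFDerivAt.hasFDerivWithinAt) ?_
      (convex_closedBall _ _) (by simp) (by simp)
    · rw [add_sub_cancel_left] at this
      rw [pow_two, ← mul_assoc]; exact this
    · intro w hw
      have h := hK1.dist_le_mul w (hsub hw) x (hsub (by simp))
      rw [dist_eq_norm] at h
      refine h.trans ?_
      gcongr
      simpa using hw
  refine ⟨2 * K1 + K2, by positivity, fun x z hx hz => ⟨?_, ?_⟩⟩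
  · have hmem : x + z ∈ closedBall (0 : E) 2 := by
      rw [mem_closedBall_zero_iff]; exact (norm_add_le _ _).trans (by linarith)
    have hmem' : x ∈ closedBall (0 : E) 2 := by
      rw [mem_closedBall_zero_iff]; linarith
    have h := hK2.dist_le_mul _ hmem _ hmem'
    rw [Real.dist_eq, dist_eq_norm, add_sub_cancel_left] at h
    refine h.trans ?_
    gcongr
    linarith [K1.coe_nonneg]
  · have h1 := hT x z hx hz
    have h2 := hT x (-z) hx (by simpa using hz)
    rw [norm_neg, map_neg, ← sub_eq_add_neg] at h2
    have : |g (x + z) + g (x - z) - 2 * g x| ≤ 2 * (K1 * ‖z‖ ^ 2) := by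
      rw [abs_le] at *
      constructor <;> linarith
    refine this.trans ?_
    have := K2.coe_nonneg
    nlinarith [sq_nonneg ‖z‖]

lemma rest_bound {d : ℕ} (hd : 2 ≤ d) {s C M : ℝ} (hs0 : 0 < s) (hs1 : s < 1) (hC0 : 0 ≤ C) (hM0 : 0 ≤ M)
    (g : EuclideanSpace ℝ (Fin d) → ℝ)
    (hC : ∀ x z : EuclideanSpace ℝ (Fin d), ‖x‖ < 1 → ‖z‖ ≤ 1 → |g (x + z) - g x| ≤ C * ‖z‖ ∧
      |g (x + z) + g (x - z) - 2 * g x| ≤ C * ‖z‖ ^ 2)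
    (hM : ∀ y, |g y| ≤ M) (x z : EuclideanSpace ℝ (Fin d)) (hx : ‖x‖ < 1) :
    |(uf s x * (g (x + z) + g (x - z) - 2 * g x) + (uf s (x + z) - uf s x) * (g (x + z) - g x)
      + (uf s (x - z) - uf s x) * (g (x - z) - g x)) * ‖z‖ ^ (-(d : ℝ) - 2 * s)| ≤
    (7 * C + 8 * M) * (domf s ‖z‖ * ‖z‖ ^ (1 - (d : ℝ))) := by
  have hdd : (2 : ℝ) ≤ d := by exact_mod_cast hd
  by_cases hz0 : z = 0
  · subst hz0
    rw [norm_zero, Real.zero_rpow (by linarith), mul_zero, abs_zero]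
    have := domf_nonneg (s := s) (le_refl (0 : ℝ))
    positivity
  have hz : 0 < ‖z‖ := norm_pos_iff.2 hz0
  set r := ‖z‖ with hr
  have hux := uf_nonneg (s := s) x
  have hux1 := uf_le_one hs0 x
  rw [abs_mul, abs_of_nonneg (Real.rpow_nonneg hz.le (-(d : ℝ) - 2 * s))]
  unfold domf
  split_ifs with h
  · obtain ⟨c1, c2⟩ := hC x z hx h
    obtain ⟨c3, -⟩ := hC x (-z) hx (by rwa [norm_neg])
    have u1 := uf_holder hs0 hs1 x z hx h
    have u2 := uf_holder hs0 hs1 x (-z) hx (by rwa [norm_neg])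
    rw [norm_neg, ← sub_eq_add_neg] at u2 c3
    rw [← hr] at u1 u2 c1 c2 c3
    have h7 : r ≤ r ^ s := by
      have := low_aux (r := 1 - r) hs0 hs1 (by linarith) (by linarith)
      simpa using this
    have e4 : r ^ (-s) * r ^ (1 - (d : ℝ)) = (r ^ s * r) * r ^ (-(d : ℝ) - 2 * s) := by
      rw [← Real.rpow_add_one hz.ne', ← Real.rpow_add hz, ← Real.rpow_add hz]; ring_nf
    rw [e4, ← mul_assoc]
    gcongr
    have hrs : 0 ≤ r ^ s := by positivity
    have b1 : |uf s x * (g (x + z) + g (x - z) - 2 * g x)| ≤ C * (r ^ s * r) := by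
      rw [abs_mul, abs_of_nonneg hux]
      calc _ ≤ 1 * (C * r ^ 2) := by gcongr
        _ = C * (r * r) := by ring
        _ ≤ _ := by gcongr
    have b2 : |(uf s (x + z) - uf s x) * (g (x + z) - g x)| ≤ 3 * r ^ s * (C * r) := by
      rw [abs_mul]; gcongr
    have b3 : |(uf s (x - z) - uf s x) * (g (x - z) - g x)| ≤ 3 * r ^ s * (C * r) := by
      rw [abs_mul]; gcongr
    calc _ ≤ _ := abs_add_three _ _ _
      _ ≤ C * (r ^ s * r) + 3 * r ^ s * (C * r) + 3 * r ^ s * (C * r) := by gcongr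
      _ = (7 * C) * (r ^ s * r) := by ring
      _ ≤ _ := by gcongr; linarith
  · push Not at h
    have e4 : r ^ (-1 - s) * r ^ (1 - (d : ℝ)) = r ^ (-(d : ℝ) - s) := by
      rw [← Real.rpow_add hz]; ring_nf
    rw [e4]
    have hk : r ^ (-(d : ℝ) - 2 * s) ≤ r ^ (-(d : ℝ) - s) :=
      Real.rpow_le_rpow_of_exponent_le h.le (by linarith)
    have gd : ∀ y, |g y - g x| ≤ 2 * M := fun y => (abs_sub _ _).trans (by linarith [hM y, hM x])
    have ud : ∀ y : EuclideanSpace ℝ (Fin d), |uf s y - uf s x| ≤ 1 := fun y => by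
      have := uf_nonneg (s := s) y
      have := uf_le_one hs0 y
      rw [abs_le]; constructor <;> linarith
    have b1 : |uf s x * (g (x + z) + g (x - z) - 2 * g x)| ≤ 1 * (4 * M) := by
      rw [abs_mul, abs_of_nonneg hux]
      gcongr
      have := gd (x + z)
      have := gd (x - z)
      rw [abs_le] at *
      constructor <;> linarith
    have b2 : ∀ y : EuclideanSpace ℝ (Fin d), |(uf s y - uf s x) * (g y - g x)| ≤ 1 * (2 * M) := by
      intro y
      rw [abs_mul]
      have := gd y
      have := ud y
      gcongr
    gcongr
    calc _ ≤ _ := abs_add_three _ _ _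
      _ ≤ 1 * (4 * M) + 1 * (2 * M) + 1 * (2 * M) := by gcongr; exact b2 _; exact b2 _
      _ ≤ _ := by linarith

/-- let `D = B(0,1) ⊂ ℝ^d` be the open unit ball, and let
`φ ∈ C(closure D) ∩ C²(D)` satisfy `φ(x) = (1−|x|)^{α/2}` whenever `x ∈ closure D` and
`1−|x| ≤ 1/2`. Then `𝓛φ` is bounded on `D`. -/
theorem stmt_5 (d : ℕ) (hd : 2 ≤ d) (α : ℝ) (hα : α ∈ Set.Ioo (0 : ℝ) 2)
    (φ : EuclideanSpace ℝ (Fin d) → ℝ)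
    (hφc : ContinuousOn φ (closure (Metric.ball (0 : EuclideanSpace ℝ (Fin d)) 1)))
    (hφ2 : ContDiffOn ℝ 2 φ (Metric.ball (0 : EuclideanSpace ℝ (Fin d)) 1))
    (hφb : ∀ x ∈ closure (Metric.ball (0 : EuclideanSpace ℝ (Fin d)) 1),
      1 - ‖x‖ ≤ 1 / 2 → φ x = (1 - ‖x‖) ^ (α / 2)) :
    ∃ M : ℝ, ∀ x ∈ Metric.ball (0 : EuclideanSpace ℝ (Fin d)) 1,
      |Lgen (Metric.ball (0 : EuclideanSpace ℝ (Fin d)) 1) α 1 φ x| ≤ M := by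
  obtain ⟨s, rfl⟩ : ∃ s, α = 2 * s := ⟨α / 2, by ring⟩
  have hs0 : 0 < s := by linarith [hα.1]
  have hs1 : s < 1 := by linarith [hα.2]
  have hb : ∀ y : EuclideanSpace ℝ (Fin d), ‖y‖ ≤ 1 → 1 - ‖y‖ ≤ 1 / 2 → φ y = (1 - ‖y‖) ^ s := by
    intro y hy hy2
    have := hφb y (by rw [closure_ball _ one_ne_zero]; simpa using hy) hy2
    rwa [mul_div_cancel_left₀ _ (two_ne_zero)] at this
  have hgs := gf_smooth hb hφ2
  have hgc := hgs.continuous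
  obtain ⟨M, hM⟩ := gf_bdd hs0 hb hgc
  have hM0 : 0 ≤ M := (abs_nonneg _).trans (hM 0)
  obtain ⟨C, hC0, hC⟩ := taylor_aux _ hgs
  set g := gf s φ with hg
  set Cu := (∫ r in Ioi 0, 4 * domf s r) * (volume : Measure (EuclideanSpace ℝ (Fin d))).toSphere.real univ with hCu
  have hdi := (dom_int hd hs0 hs1).const_mul (7 * C + 8 * M)
  set Cr := ∫ z : EuclideanSpace ℝ (Fin d), (7 * C + 8 * M) * (domf s ‖z‖ * ‖z‖ ^ (1 - (d : ℝ))) with hCr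
  have hCu0 : 0 ≤ Cu := by
    refine mul_nonneg (setIntegral_nonneg measurableSet_Ioi fun r hr => ?_) measureReal_nonneg
    have := domf_nonneg (s := s) (le_of_lt hr)
    positivity
  have hCr0 : 0 ≤ Cr := by
    refine integral_nonneg fun z => ?_
    have := domf_nonneg (s := s) (norm_nonneg z)
    positivity
  refine ⟨M * Cu + Cr, fun x hx => ?_⟩
  have hx : ‖x‖ < 1 := by simpa using hx
  unfold Lgen
  set F : EuclideanSpace ℝ (Fin d) → ℝ := fun z => (φ (Lam (ball (0 : EuclideanSpace ℝ (Fin d)) 1) x (x + z)) - φ x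
    - (if ‖z‖ < 1 then ⟪z, gradient φ x⟫ else 0)) * ‖z‖ ^ (-(d : ℝ) - 2 * s) with hF
  by_cases hFi : Integrable F
  swap
  · rw [integral_undef hFi, abs_zero]; positivity
  set k : EuclideanSpace ℝ (Fin d) → ℝ := fun z => ‖z‖ ^ (-(d : ℝ) - 2 * s) with hk
  set U : EuclideanSpace ℝ (Fin d) → ℝ := fun z =>
    (uf s (x + z) + uf s (x - z) - 2 * uf s x) * ‖z‖ ^ (-(d : ℝ) - 2 * s) with hU
  set Rr : EuclideanSpace ℝ (Fin d) → ℝ := fun z =>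
    (uf s x * (g (x + z) + g (x - z) - 2 * g x) + (uf s (x + z) - uf s x) * (g (x + z) - g x)
      + (uf s (x - z) - uf s x) * (g (x - z) - g x)) * ‖z‖ ^ (-(d : ℝ) - 2 * s) with hRr
  have hφx : φ x = uf s x * g x := by
    rw [hg, gf_in hb hx, mul_div_cancel₀ _ (uf_pos hx).ne']
  have hsym : ∀ z, F z + F (-z) = g x * U z + Rr z := by
    intro z
    simp only [hF, hU, hRr]
    rw [phi_eq hs0 hb x z hx, phi_eq hs0 hb x (-z) hx, hφx, norm_neg, ← sub_eq_add_neg, inner_neg_left,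
      ← hg]
    split_ifs <;> ring
  have hkm : Measurable k := by simp only [hk]; fun_prop
  have huc := uf_cont (d := d) hs0
  have hRb : ∀ z, ‖Rr z‖ ≤ (7 * C + 8 * M) * (domf s ‖z‖ * ‖z‖ ^ (1 - (d : ℝ))) := fun z =>
    rest_bound hd hs0 hs1 hC0 hM0 g hC hM x z hx
  have hRm : Measurable Rr := by
    refine Measurable.mul (Continuous.measurable ?_) hkm
    fun_prop
  have hRi : Integrable Rr := Integrable.mono' hdi hRm.aestronglyMeasurable (.of_forall hRb)
  have hRI : |∫ z, Rr z| ≤ Cr := norm_integral_le_of_norm_le hdi (.of_forall hRb)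
  have hFi2 : Integrable (fun z => F (-z)) := hFi.comp_neg
  have hTi : Integrable (fun z => g x * U z) := by
    refine ((hFi.add hFi2).sub hRi).congr (.of_forall fun z => ?_)
    simp only [Pi.add_apply, Pi.sub_apply, hsym]; ring
  have hTb : |∫ z, g x * U z| ≤ M * Cu := by
    rw [integral_const_mul, abs_mul]
    by_cases hg0 : g x = 0
    · rw [hg0, abs_zero, zero_mul]; positivity
    have hUi : Integrable U := by
      refine (hTi.const_mul (g x)⁻¹).congr (.of_forall fun z => ?_)
      simp only
      field_simp
    have := uf_bound hd hs0 hs1 x hx hUi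
    have := hM x
    gcongr
  have h2 : (∫ z, F z) + ∫ z, F z = (∫ z, g x * U z) + ∫ z, Rr z := by
    rw [← integral_add hTi hRi]
    nth_rewrite 2 [← integral_neg_eq_self]
    rw [← integral_add hFi hFi2]
    exact integral_congr_ae (.of_forall hsym)
  have h3 := abs_le.1 hTb
  have h4 := abs_le.1 hRI
  have : 0 ≤ M * Cu := by positivity
  rw [abs_le]
  constructor <;> linarith
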